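/- Let c > 0 and k > 0 be real numbers, and for each integer n ≥ 1 define q_n : ℝ → ℝ by q_n(x) = √(c/n) · e^{−x²/(2n²)} · cos(2kx). Then, as n → ∞: (i) ∫_ℝ (1/2) q_n(x)² dx → (√π/4) c; (ii) ∫_ℝ [ (1/2) q_n′(x)² + q_n(x)³ ] dx → √π c k²; and (iii) ∫_ℝ [ (1/2) q_n″(x)² + 5 q_n(x) q_n′(x)² + (5/2) q_n(x)⁴ ] dx → 4√π c k⁴. -/

import Mathlib

open MeasureTheory Filter

/-- The Wigner–von Neumann-type ansatz `q_n(x) = √(c/n) e^{-x²/(2n²)} cos(2kx)`. -/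
noncomputable def wvnSeq (c k : ℝ) (n : ℕ) (x : ℝ) : ℝ :=
  Real.sqrt (c / (n : ℝ)) * Real.exp (-(x ^ 2) / (2 * (n : ℝ) ^ 2)) *
    Real.cos (2 * k * x)

lemma wvn_int_gauss : Integrable (fun y : ℝ => Real.exp (-y ^ 2)) := by
  have := integrable_exp_neg_mul_sq (b := 1) one_pos
  simpa using this

lemma wvn_int_weight :
    Integrable (fun y : ℝ => Real.exp (-y ^ 2) * (1 + y ^ 2) ^ 2) := by
  have h2 := integrable_rpow_mul_exp_neg_mul_sq (b := 1) one_pos (s := ((2 : ℕ) : ℝ)) (by norm_num)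
  have h4 := integrable_rpow_mul_exp_neg_mul_sq (b := 1) one_pos (s := ((4 : ℕ) : ℝ)) (by norm_num)
  simp only [Real.rpow_natCast] at h2 h4
  refine ((wvn_int_gauss.add (h2.const_mul 2)).add h4).congr ?_
  refine Eventually.of_forall fun y => ?_
  simp only [Pi.add_apply, neg_mul, one_mul]
  ring

lemma wvn_gauss_cos (t : ℝ) :
    ∫ y : ℝ, Real.exp (-y ^ 2) * Real.cos (t * y) = Real.sqrt Real.pi * Real.exp (-t ^ 2 / 4) := by
  have h := fourierIntegral_gaussian (b := 1) (by simp) (t : ℂ)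
  have h1 : Integrable (fun x : ℝ => Complex.exp (Complex.I * t * x) * Complex.exp (-1 * (x : ℂ) ^ 2)) := by
    refine wvn_int_gauss.mono' (by fun_prop) (Eventually.of_forall fun x => ?_)
    rw [norm_mul, Complex.norm_exp, Complex.norm_exp]
    simp [← Complex.ofReal_pow]
  have h2 := congrArg Complex.re h
  have h3 := integral_re (𝕜 := ℂ) h1
  simp only [RCLike.re_eq_complex_re] at h3
  rw [← h3] at h2
  have e : ∀ y : ℝ, (Complex.exp (Complex.I * t * y) * Complex.exp (-1 * (y : ℂ) ^ 2)).re
      = Real.exp (-y ^ 2) * Real.cos (t * y) := by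
    intro y
    rw [← Complex.exp_add, Complex.exp_re]
    simp [← Complex.ofReal_pow]
  simp only [e] at h2
  rw [h2]
  have e2 : ((Real.pi : ℂ) / 1) ^ (1 / 2 : ℂ) * Complex.exp (-(t : ℂ) ^ 2 / (4 * 1))
      = ((Real.sqrt Real.pi * Real.exp (-t ^ 2 / 4) : ℝ) : ℂ) := by
    rw [Real.sqrt_eq_rpow, Complex.ofReal_mul, Complex.ofReal_cpow Real.pi_pos.le]
    push_cast
    simp
  rw [e2, Complex.ofReal_re]

lemma wvn_D_tendsto : Tendsto (fun n : ℕ => (Real.sqrt (n : ℝ))⁻¹) atTop (nhds 0) :=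
  tendsto_inv_atTop_zero.comp (Real.tendsto_sqrt_atTop.comp tendsto_natCast_atTop_atTop)

lemma wvn_main (k : ℝ) (hk : 0 < k) (f P : ℕ → ℝ → ℝ) (A B K : ℝ)
    (hP : ∀ n, Continuous (P n))
    (hb : ∀ n : ℕ, 1 ≤ n → ∀ y, |P n y| ≤ K * (1 + y ^ 2) ^ 2)
    (hf : ∀ n : ℕ, 1 ≤ n → ∀ y, (n : ℝ) * f n (n * y) =
      Real.exp (-y ^ 2) * (A + B * Real.cos (4 * k * n * y) + (Real.sqrt n)⁻¹ * P n y)) :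
    Tendsto (fun n => ∫ x, f n x) atTop (nhds (A * Real.sqrt Real.pi)) := by
  have hI : ∀ n : ℕ, 1 ≤ n → Integrable (fun y => Real.exp (-y ^ 2) * P n y) := by
    intro n hn
    refine (wvn_int_weight.const_mul K).mono'
      ((by have := hP n; fun_prop : Continuous _).aestronglyMeasurable)
      (Eventually.of_forall fun y => ?_)
    rw [norm_mul, Real.norm_eq_abs, Real.norm_eq_abs, abs_of_pos (Real.exp_pos _)]
    nlinarith [hb n hn y, Real.exp_pos (-y ^ 2)]
  have hIc : ∀ t : ℝ, Integrable (fun y => Real.exp (-y ^ 2) * Real.cos (t * y)) := by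
    intro t
    refine wvn_int_gauss.mono' (by fun_prop) (Eventually.of_forall fun y => ?_)
    rw [norm_mul, Real.norm_eq_abs, Real.norm_eq_abs, abs_of_pos (Real.exp_pos _)]
    nlinarith [Real.abs_cos_le_one (t * y), Real.exp_pos (-y ^ 2)]
  have hg : ∫ y : ℝ, Real.exp (-y ^ 2) = Real.sqrt Real.pi := by
    simpa using integral_gaussian 1
  have hval : ∀ n : ℕ, 1 ≤ n → ∫ x, f n x = A * Real.sqrt Real.pi +
      B * (Real.sqrt Real.pi * Real.exp (-(4 * k * n) ^ 2 / 4)) +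
      (Real.sqrt n)⁻¹ * ∫ y, Real.exp (-y ^ 2) * P n y := by
    intro n hn
    have hn0 : (0 : ℝ) < n := by exact_mod_cast hn
    have h1 := Measure.integral_comp_mul_left (f n) (n : ℝ)
    have h2 : ∫ x, f n x = ∫ y, (n : ℝ) * f n (n * y) := by
      rw [integral_const_mul, h1, abs_of_pos (inv_pos.2 hn0), smul_eq_mul]
      field_simp
    rw [h2, ← wvn_gauss_cos, ← hg, ← integral_const_mul, ← integral_const_mul,
      ← integral_const_mul, ← integral_add, ← integral_add]
    · refine integral_congr_ae (Eventually.of_forall fun y => ?_)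
      simp only [hf n hn y]
      ring
    · exact (wvn_int_gauss.const_mul A).add ((hIc _).const_mul B)
    · exact (hI n hn).const_mul _
    · exact wvn_int_gauss.const_mul A
    · exact (hIc _).const_mul B
  have hev : (fun n => ∫ x, f n x) =ᶠ[atTop] fun n : ℕ => A * Real.sqrt Real.pi +
      B * (Real.sqrt Real.pi * Real.exp (-(4 * k * n) ^ 2 / 4)) +
      (Real.sqrt n)⁻¹ * ∫ y, Real.exp (-y ^ 2) * P n y := by
    filter_upwards [eventually_ge_atTop 1] with n hn using hval n hn
  refine Tendsto.congr' hev.symm ?_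
  have t1 : Tendsto (fun n : ℕ => Real.exp (-(4 * k * n) ^ 2 / 4)) atTop (nhds 0) := by
    refine Real.tendsto_exp_atBot.comp ?_
    have a1 : Tendsto (fun n : ℕ => (n : ℝ) ^ 2) atTop atTop :=
      (tendsto_pow_atTop two_ne_zero).comp tendsto_natCast_atTop_atTop
    have a2 := a1.const_mul_atTop_of_neg (r := -(4 * k ^ 2)) (by nlinarith [pow_pos hk 2])
    refine a2.congr fun n => ?_
    ring
  have t2 : Tendsto (fun n : ℕ => (Real.sqrt n)⁻¹ * ∫ y, Real.exp (-y ^ 2) * P n y)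
      atTop (nhds 0) := by
    have t3 := wvn_D_tendsto.mul_const (∫ y, K * (Real.exp (-y ^ 2) * (1 + y ^ 2) ^ 2))
    rw [zero_mul] at t3
    refine squeeze_zero_norm' ?_ t3
    filter_upwards [eventually_ge_atTop 1] with n hn
    rw [norm_mul, Real.norm_eq_abs, abs_of_nonneg (by positivity)]
    refine mul_le_mul_of_nonneg_left ?_ (by positivity)
    refine norm_integral_le_of_norm_le (wvn_int_weight.const_mul K)
      (Eventually.of_forall fun y => ?_)
    rw [norm_mul, Real.norm_eq_abs, Real.norm_eq_abs, abs_of_pos (Real.exp_pos _)]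
    nlinarith [hb n hn y, Real.exp_pos (-y ^ 2)]
  have := ((t1.const_mul (Real.sqrt Real.pi)).const_mul B).const_add (A * Real.sqrt Real.pi)
  simpa using this.add t2

lemma wvn_deriv (c k : ℝ) (n : ℕ) (hn : 1 ≤ n) :
    deriv (wvnSeq c k n) = fun x => Real.sqrt (c / (n : ℝ)) *
      Real.exp (-(x ^ 2) / (2 * (n : ℝ) ^ 2)) *
      (-(x / (n : ℝ) ^ 2) * Real.cos (2 * k * x) - 2 * k * Real.sin (2 * k * x)) := by
  have hn0 : (n : ℝ) ≠ 0 := by positivity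
  funext x
  have hE : HasDerivAt (fun x : ℝ => Real.exp (-(x ^ 2) / (2 * (n : ℝ) ^ 2)))
      (Real.exp (-(x ^ 2) / (2 * (n : ℝ) ^ 2)) * (-(2 * x) / (2 * (n : ℝ) ^ 2))) x := by
    have := (((hasDerivAt_pow 2 x).neg).div_const (2 * (n : ℝ) ^ 2)).exp
    simpa using this
  have hL : HasDerivAt (fun x : ℝ => 2 * k * x) (2 * k) x := by
    simpa using (hasDerivAt_id x).const_mul (2 * k)
  have h := (hE.const_mul (Real.sqrt (c / (n : ℝ)))).mul hL.cos
  have h' : HasDerivAt (wvnSeq c k n) _ x := h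
  rw [h'.deriv]
  field_simp
  ring

lemma wvn_deriv2 (c k : ℝ) (n : ℕ) (hn : 1 ≤ n) :
    deriv (deriv (wvnSeq c k n)) = fun x => Real.sqrt (c / (n : ℝ)) *
      Real.exp (-(x ^ 2) / (2 * (n : ℝ) ^ 2)) *
      ((x ^ 2 / (n : ℝ) ^ 4 - 1 / (n : ℝ) ^ 2 - 4 * k ^ 2) * Real.cos (2 * k * x)
        + 4 * k * (x / (n : ℝ) ^ 2) * Real.sin (2 * k * x)) := by
  have hn0 : (n : ℝ) ≠ 0 := by positivity
  rw [wvn_deriv c k n hn]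
  funext x
  have hE : HasDerivAt (fun x : ℝ => Real.exp (-(x ^ 2) / (2 * (n : ℝ) ^ 2)))
      (Real.exp (-(x ^ 2) / (2 * (n : ℝ) ^ 2)) * (-(2 * x) / (2 * (n : ℝ) ^ 2))) x := by
    have := (((hasDerivAt_pow 2 x).neg).div_const (2 * (n : ℝ) ^ 2)).exp
    simpa using this
  have hL : HasDerivAt (fun x : ℝ => 2 * k * x) (2 * k) x := by
    simpa using (hasDerivAt_id x).const_mul (2 * k)
  have hX : HasDerivAt (fun x : ℝ => -(x / (n : ℝ) ^ 2)) (-(1 / (n : ℝ) ^ 2)) x :=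
    ((hasDerivAt_id x).div_const _).neg
  have h := (hE.const_mul (Real.sqrt (c / (n : ℝ)))).mul
    ((hX.mul hL.cos).sub (hL.sin.const_mul (2 * k)))
  refine h.deriv.trans ?_
  simp only [Pi.mul_apply, Pi.sub_apply]
  field_simp
  ring

lemma wvn_sq_le (D y : ℝ) (h0 : 0 ≤ D) (h1 : D ≤ 1) : |D * y| ≤ 1 + y ^ 2 := by
  rw [abs_mul, abs_of_nonneg h0]
  nlinarith [sq_abs y, abs_nonneg y, sq_nonneg (|y| - 1)]

theorem stmt_14 (c k : ℝ) (hc : 0 < c) (hk : 0 < k) :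
    Tendsto (fun n : ℕ => ∫ x : ℝ, (1 / 2) * wvnSeq c k n x ^ 2)
      atTop (nhds (Real.sqrt Real.pi / 4 * c)) ∧
    Tendsto (fun n : ℕ =>
        ∫ x : ℝ, ((1 / 2) * (deriv (wvnSeq c k n) x) ^ 2 + wvnSeq c k n x ^ 3))
      atTop (nhds (Real.sqrt Real.pi * c * k ^ 2)) ∧
    Tendsto (fun n : ℕ =>
        ∫ x : ℝ, ((1 / 2) * (deriv (deriv (wvnSeq c k n)) x) ^ 2 +
          5 * wvnSeq c k n x * (deriv (wvnSeq c k n) x) ^ 2 +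
          (5 / 2) * wvnSeq c k n x ^ 4))
      atTop (nhds (4 * Real.sqrt Real.pi * c * k ^ 4)) := by
  have hq : ∀ n : ℕ, 1 ≤ n → ∀ y : ℝ, Real.sqrt (c / (n : ℝ)) *
      Real.exp (-((n * y) ^ 2) / (2 * (n : ℝ) ^ 2)) =
      Real.sqrt c * (Real.sqrt n)⁻¹ * Real.exp (-y ^ 2 / 2) := by
    intro n hn y
    have hn0 : (n : ℝ) ≠ 0 := by positivity
    rw [Real.sqrt_div hc.le, div_eq_mul_inv]
    congr 2
    field_simp
  have hcc : Real.sqrt c ^ 2 = c := Real.sq_sqrt hc.le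
  have hD0 : ∀ n : ℕ, 0 ≤ (Real.sqrt (n : ℝ))⁻¹ := fun n => by positivity
  have hD1 : ∀ n : ℕ, 1 ≤ n → (Real.sqrt (n : ℝ))⁻¹ ≤ 1 := fun n hn =>
    inv_le_one_of_one_le₀ (Real.one_le_sqrt.2 (by exact_mod_cast hn))
  have hnD : ∀ n : ℕ, 1 ≤ n → (n : ℝ) * (Real.sqrt (n : ℝ))⁻¹ ^ 2 = 1 := fun n hn => by
    have hn0 : (n : ℝ) ≠ 0 := by positivity
    rw [inv_pow, Real.sq_sqrt (Nat.cast_nonneg n)]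
    field_simp
  have hninv : ∀ n : ℕ, (n : ℝ)⁻¹ = (Real.sqrt (n : ℝ))⁻¹ ^ 2 := fun n => by
    rw [inv_pow, Real.sq_sqrt (Nat.cast_nonneg n)]
  have hEE : ∀ y : ℝ, Real.exp (-y ^ 2) = Real.exp (-y ^ 2 / 2) ^ 2 := fun y => by
    rw [← Real.exp_nat_mul]; congr 1; push_cast; ring
  have hcos : ∀ (n : ℕ) (y : ℝ), Real.cos (4 * k * n * y) =
      2 * Real.cos (2 * k * (n * y)) ^ 2 - 1 := fun n y => by
    rw [← Real.cos_two_mul]; congr 1; ring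
  have hE1 : ∀ y : ℝ, Real.exp (-y ^ 2 / 2) ≤ 1 := fun y =>
    Real.exp_le_one_iff.2 (by nlinarith [sq_nonneg y])
  have hx1 : ∀ n : ℕ, 1 ≤ n → ∀ y : ℝ, (n : ℝ) * y / (n : ℝ) ^ 2 = (Real.sqrt (n : ℝ))⁻¹ ^ 2 * y := by
    intro n hn y
    have hn0 : (n : ℝ) ≠ 0 := by positivity
    rw [← hninv]; field_simp
  have hx2 : ∀ n : ℕ, 1 ≤ n → ∀ y : ℝ, ((n : ℝ) * y) ^ 2 / (n : ℝ) ^ 4 - 1 / (n : ℝ) ^ 2 =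
      (Real.sqrt (n : ℝ))⁻¹ ^ 4 * (y ^ 2 - 1) := by
    intro n hn y
    have hn0 : (n : ℝ) ≠ 0 := by positivity
    rw [show (Real.sqrt (n : ℝ))⁻¹ ^ 4 = ((Real.sqrt (n : ℝ))⁻¹ ^ 2) ^ 2 by ring, ← hninv]
    field_simp
  have hs0 := Real.sqrt_nonneg c
  refine ⟨?_, ?_, ?_⟩
  · have := wvn_main k hk (fun n x => (1 / 2) * wvnSeq c k n x ^ 2) (fun _ _ => 0)
      (c / 4) (c / 4) 0 (fun n => continuous_const) (by simp) (by
        intro n hn y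
        simp only [wvnSeq, hq n hn y, hcos, hEE]
        generalize Real.exp (-y ^ 2 / 2) = E
        generalize Real.cos (2 * k * (n * y)) = C
        have h := hnD n hn
        generalize (Real.sqrt (n : ℝ))⁻¹ = D at *
        linear_combination (1 / 2 * Real.sqrt c ^ 2 * E ^ 2 * C ^ 2) * h
          + (1 / 2 * E ^ 2 * C ^ 2) * hcc)
    convert this using 2
    ring
  · have := wvn_main k hk (fun n x => (1 / 2) * (deriv (wvnSeq c k n) x) ^ 2 + wvnSeq c k n x ^ 3)
      (fun n y => c * ((Real.sqrt (n : ℝ))⁻¹ * ((Real.sqrt (n : ℝ))⁻¹ * y) ^ 2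
          * Real.cos (2 * k * (n * y)) ^ 2 / 2
        + 2 * k * ((Real.sqrt (n : ℝ))⁻¹ * y) * Real.cos (2 * k * (n * y)) * Real.sin (2 * k * (n * y))
        + Real.sqrt c * Real.exp (-y ^ 2 / 2) * Real.cos (2 * k * (n * y)) ^ 3))
      (c * k ^ 2) (-(c * k ^ 2)) (c * (1 / 2 + 2 * k + Real.sqrt c)) (fun n => by fun_prop) (by
        intro n hn y
        have hE := hE1 y
        have hE0 := Real.exp_pos (-y ^ 2 / 2)
        have hC := Real.abs_cos_le_one (2 * k * (n * y))
        have hS := Real.abs_sin_le_one (2 * k * (n * y))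
        have hz := wvn_sq_le _ y (hD0 n) (hD1 n hn)
        have hd0 := hD0 n
        have hd1 := hD1 n hn
        have hW : 1 ≤ 1 + y ^ 2 := by nlinarith [sq_nonneg y]
        generalize (Real.sqrt (n : ℝ))⁻¹ * y = z at *
        generalize (Real.sqrt (n : ℝ))⁻¹ = D at *
        generalize Real.exp (-y ^ 2 / 2) = E at *
        generalize Real.cos (2 * k * (n * y)) = C at *
        generalize Real.sin (2 * k * (n * y)) = S at *
        generalize 1 + y ^ 2 = W at *
        rw [abs_mul, abs_of_pos hc, mul_assoc c]
        refine mul_le_mul_of_nonneg_left ?_ hc.le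
        have hW2 : W ≤ W ^ 2 := by nlinarith
        have b1 : |D * z ^ 2 * C ^ 2 / 2| ≤ 1 * W ^ 2 * 1 ^ 2 / 2 := by
          rw [abs_div, abs_mul, abs_mul, abs_pow, abs_pow, abs_of_nonneg hd0, abs_two]
          gcongr
        have b2 : |2 * k * z * C * S| ≤ 2 * k * W * 1 * 1 := by
          rw [abs_mul, abs_mul, abs_mul, abs_of_pos (by positivity : 0 < 2 * k)]
          gcongr
        have b3 : |Real.sqrt c * E * C ^ 3| ≤ Real.sqrt c * 1 * 1 ^ 3 := by
          rw [abs_mul, abs_mul, abs_pow, abs_of_nonneg hs0, abs_of_pos hE0]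
          gcongr
        refine (abs_add_three _ _ _).trans ?_
        nlinarith) (by
        intro n hn y
        have hSC := Real.sin_sq_add_cos_sq (2 * k * (n * y))
        simp only [wvn_deriv c k n hn, wvnSeq, hq n hn y, hcos, hEE, hx1 n hn]
        generalize Real.exp (-y ^ 2 / 2) = E
        generalize Real.cos (2 * k * (n * y)) = C at *
        generalize Real.sin (2 * k * (n * y)) = S at *
        have h := hnD n hn
        generalize (Real.sqrt (n : ℝ))⁻¹ = D at *
        generalize Real.sqrt c = r at *
        subst hcc
        linear_combination (r ^ 2 * E ^ 2 * (1 / 2 * (D ^ 2 * y * C + 2 * k * S) ^ 2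
          + r * D * E * C ^ 3)) * h + (2 * r ^ 2 * k ^ 2 * E ^ 2) * hSC)
    convert this using 2
    ring
  · have := wvn_main k hk (fun n x => (1 / 2) * (deriv (deriv (wvnSeq c k n)) x) ^ 2 +
          5 * wvnSeq c k n x * (deriv (wvnSeq c k n) x) ^ 2 +
          (5 / 2) * wvnSeq c k n x ^ 4)
      (fun n y => c * ((Real.sqrt (n : ℝ))⁻¹ * ((Real.sqrt (n : ℝ))⁻¹ ^ 3 * (y ^ 2 - 1) * Real.cos (2 * k * (n * y))
            + 4 * k * ((Real.sqrt (n : ℝ))⁻¹ * y) * Real.sin (2 * k * (n * y))) ^ 2 / 2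
        + -(4 * k ^ 2 * Real.cos (2 * k * (n * y)) * ((Real.sqrt (n : ℝ))⁻¹ ^ 3 * (y ^ 2 - 1) * Real.cos (2 * k * (n * y))
            + 4 * k * ((Real.sqrt (n : ℝ))⁻¹ * y) * Real.sin (2 * k * (n * y))))
        + 5 * Real.sqrt c * Real.exp (-y ^ 2 / 2) * Real.cos (2 * k * (n * y))
          * ((Real.sqrt (n : ℝ))⁻¹ * ((Real.sqrt (n : ℝ))⁻¹ * y) * Real.cos (2 * k * (n * y))
            + 2 * k * Real.sin (2 * k * (n * y))) ^ 2
        + 5 / 2 * c * (Real.sqrt (n : ℝ))⁻¹ * Real.exp (-y ^ 2 / 2) ^ 2 * Real.cos (2 * k * (n * y)) ^ 4))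
      (4 * c * k ^ 4) (4 * c * k ^ 4)
      (c * ((1 + 4 * k) ^ 2 / 2 + 4 * k ^ 2 * (1 + 4 * k) + 5 * Real.sqrt c * (1 + 2 * k) ^ 2 + 5 / 2 * c))
      (fun n => by fun_prop) (by
        intro n hn y
        have hE := hE1 y
        have hE0 := Real.exp_pos (-y ^ 2 / 2)
        have hC := Real.abs_cos_le_one (2 * k * (n * y))
        have hS := Real.abs_sin_le_one (2 * k * (n * y))
        have hz := wvn_sq_le _ y (hD0 n) (hD1 n hn)
        have hd0 := hD0 n
        have hd1 := hD1 n hn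
        have hW : 1 ≤ 1 + y ^ 2 := by nlinarith [sq_nonneg y]
        have hV : |y ^ 2 - 1| ≤ 1 + y ^ 2 := by
          rw [abs_le]; constructor <;> nlinarith [sq_nonneg y]
        generalize (Real.sqrt (n : ℝ))⁻¹ * y = z at *
        generalize (Real.sqrt (n : ℝ))⁻¹ = D at *
        generalize Real.exp (-y ^ 2 / 2) = E at *
        generalize Real.cos (2 * k * (n * y)) = C at *
        generalize Real.sin (2 * k * (n * y)) = S at *
        generalize 1 + y ^ 2 = W at *
        generalize y ^ 2 - 1 = V at *
        have hW2 : W ≤ W ^ 2 := by nlinarith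
        have hu : |D ^ 3 * V * C + 4 * k * z * S| ≤ (1 + 4 * k) * W := by
          have a1 : |D ^ 3 * V * C| ≤ 1 ^ 3 * W * 1 := by
            rw [abs_mul, abs_mul, abs_pow, abs_of_nonneg hd0]
            gcongr
          have a2 : |4 * k * z * S| ≤ 4 * k * W * 1 := by
            rw [abs_mul, abs_mul, abs_of_pos (by positivity : 0 < 4 * k)]
            gcongr
          refine (abs_add_le _ _).trans ?_
          linarith
        have hv : |D * z * C + 2 * k * S| ≤ (1 + 2 * k) * W := by
          have a1 : |D * z * C| ≤ 1 * W * 1 := by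
            rw [abs_mul, abs_mul, abs_of_nonneg hd0]
            gcongr
          have a2 : |2 * k * S| ≤ 2 * k * 1 := by
            rw [abs_mul, abs_of_pos (by positivity : 0 < 2 * k)]
            gcongr
          refine (abs_add_le _ _).trans ?_
          nlinarith
        generalize D ^ 3 * V * C + 4 * k * z * S = u at *
        generalize D * z * C + 2 * k * S = v at *
        rw [abs_mul, abs_of_pos hc, mul_assoc c]
        refine mul_le_mul_of_nonneg_left ?_ hc.le
        have b1 : |D * u ^ 2 / 2| ≤ 1 * ((1 + 4 * k) * W) ^ 2 / 2 := by
          rw [abs_div, abs_mul, abs_pow, abs_of_nonneg hd0, abs_two]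
          gcongr
        have b2 : |-(4 * k ^ 2 * C * u)| ≤ 4 * k ^ 2 * 1 * ((1 + 4 * k) * W ^ 2) := by
          rw [abs_neg, abs_mul, abs_mul, abs_of_pos (by positivity : 0 < 4 * k ^ 2)]
          have : |u| ≤ (1 + 4 * k) * W ^ 2 := hu.trans (by gcongr)
          gcongr
        have b3 : |5 * Real.sqrt c * E * C * v ^ 2| ≤
            5 * Real.sqrt c * 1 * 1 * ((1 + 2 * k) * W) ^ 2 := by
          rw [abs_mul, abs_mul, abs_mul, abs_pow,
            abs_of_nonneg (by positivity : 0 ≤ 5 * Real.sqrt c), abs_of_pos hE0]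
          gcongr
        have b4 : |5 / 2 * c * D * E ^ 2 * C ^ 4| ≤ 5 / 2 * c * 1 * 1 ^ 2 * 1 ^ 4 := by
          rw [abs_mul, abs_mul, abs_mul, abs_pow, abs_pow,
            abs_of_pos (by positivity : 0 < 5 / 2 * c), abs_of_pos hE0, abs_of_nonneg hd0]
          gcongr
        have b5 : 5 / 2 * c * 1 ≤ 5 / 2 * c * W ^ 2 := by
          have : 1 ≤ W ^ 2 := hW.trans hW2
          gcongr
        refine (abs_add_le _ _).trans ((add_le_add_left (abs_add_three _ _ _) _).trans ?_)
        linarith) (by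
        intro n hn y
        have hSC := Real.sin_sq_add_cos_sq (2 * k * (n * y))
        rw [wvn_deriv2 c k n hn]
        simp only [wvn_deriv c k n hn, wvnSeq, hq n hn y, hcos, hEE,
          hx1 n hn, hx2 n hn]
        generalize Real.exp (-y ^ 2 / 2) = E
        generalize Real.cos (2 * k * (n * y)) = C at *
        generalize Real.sin (2 * k * (n * y)) = S at *
        have h := hnD n hn
        generalize (Real.sqrt (n : ℝ))⁻¹ = D at *
        generalize Real.sqrt c = r at *
        subst hcc
        linear_combination (r ^ 2 * E ^ 2 * (1 / 2 * ((D ^ 4 * (y ^ 2 - 1) - 4 * k ^ 2) * C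
            + 4 * k * (D ^ 2 * y) * S) ^ 2
          + 5 * r * D * E * C * (D ^ 2 * y * C + 2 * k * S) ^ 2
          + 5 / 2 * r ^ 2 * D ^ 2 * E ^ 2 * C ^ 4)) * h)
    convert this using 2
    ring
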